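/- arXiv:1211.4951 — 3 statements merged into one kernel-verified Lean document; each statement's English description precedes it below -/
import Mathlib

section
/- Let n be a positive integer and let (p,q) ∈ (ℤ/nℤ)². Then there exists a matrix M ∈ SL₂(ℤ) such that the action of M on (ℤ/nℤ)² sends (p,q) to (g(p,q) mod n, 0), where g(p,q) = gcd(p̃, gcd(q̃, n)) and p̃, q̃ ∈ {0,…,n−1} are the canonical integer representatives of p and q. -/
/-- The action of `SL₂(ℤ)` on `(ℤ/nℤ)²`: reduce the matrix entries modulo `n` and
multiply the column vector `(v.1, v.2)`. -/
def sl2Smul (n : ℕ) (M : Matrix.SpecialLinearGroup (Fin 2) ℤ) (v : ZMod n × ZMod n) :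
    ZMod n × ZMod n :=
  (((M.1 0 0 : ℤ) : ZMod n) * v.1 + ((M.1 0 1 : ℤ) : ZMod n) * v.2,
   ((M.1 1 0 : ℤ) : ZMod n) * v.1 + ((M.1 1 1 : ℤ) : ZMod n) * v.2)

/-- `g(p,q) = gcd(p̃, gcd(q̃, n))`, where `p̃, q̃ ∈ {0,…,n−1}` are the canonical
integer representatives of `p` and `q`. -/
def gInv (n : ℕ) (v : ZMod n × ZMod n) : ℕ :=
  Nat.gcd v.1.val (Nat.gcd v.2.val n)

/-- A residue class coprime to its modulus contains an element coprime to any given nonzero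
number. -/
theorem Nat.Coprime.exists_coprime_natCast_eq {a b m : ℕ} (hab : a.Coprime b) (hb : b ≠ 0)
    (hm : m ≠ 0) : ∃ c : ℕ, c.Coprime m ∧ (c : ZMod b) = a := by
  have : NeZero (b * m) := ⟨mul_ne_zero hb hm⟩
  obtain ⟨u, hu⟩ := ZMod.unitsMap_surjective (Dvd.intro m rfl : b ∣ b * m)
    (ZMod.unitOfCoprime a hab)
  refine ⟨(u : ZMod (b * m)).val, (ZMod.val_coe_unit_coprime u).coprime_mul_left_right, ?_⟩
  have h := congrArg Units.val hu
  rwa [ZMod.unitsMap_val, ZMod.coe_unitOfCoprime, ← ZMod.natCast_val] at h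

/-- The residue class of `a` modulo `n` contains an element whose gcd with `m` is
`gcd(a, gcd(m, n))`. -/
theorem Nat.exists_gcd_eq_natCast_eq (a : ℕ) {m n : ℕ} (hm : m ≠ 0) (hn : n ≠ 0) :
    ∃ c : ℕ, c.gcd m = a.gcd (m.gcd n) ∧ (c : ZMod n) = a := by
  obtain ⟨x, y, hxy, hx, hy⟩ := Nat.exists_coprime a n
  generalize he : a.gcd n = e at hx hy
  have hy0 : y ≠ 0 := by rintro rfl; exact hn (by simpa using hy)
  obtain ⟨c, hcm, hc⟩ := hxy.exists_coprime_natCast_eq hy0 hm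
  refine ⟨c * e, ?_, ?_⟩
  · rw [Nat.Coprime.gcd_mul_left_cancel e hcm, ← he, Nat.gcd_assoc, Nat.gcd_comm n m]
  · rw [ZMod.natCast_eq_natCast_iff] at hc ⊢
    rw [hx, hy]
    exact hc.mul_right' e

/-- Some element of `SL₂(ℤ)` sends the column `(a, b)` to `(gcd(a, b), 0)`. -/
theorem exists_sl2_mul_add_eq_gcd (a b : ℤ) :
    ∃ M : Matrix.SpecialLinearGroup (Fin 2) ℤ,
      M.1 0 0 * a + M.1 0 1 * b = Int.gcd a b ∧ M.1 1 0 * a + M.1 1 1 * b = 0 := by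
  rcases (Int.gcd a b).eq_zero_or_pos with h0 | hpos
  · obtain ⟨rfl, rfl⟩ := Int.gcd_eq_zero_iff.mp h0
    exact ⟨1, by simp⟩
  · obtain ⟨x, y, hxy, hx, hy⟩ := Int.exists_gcd_one hpos
    obtain ⟨u, v, huv⟩ := Int.isCoprime_iff_gcd_eq_one.mpr hxy
    refine ⟨⟨!![u, v; -y, x], by rw [Matrix.det_fin_two_of]; linear_combination huv⟩, ?_, ?_⟩
    · simp only [Matrix.of_apply, Matrix.cons_val]
      linear_combination u * hx + v * hy + (Int.gcd a b : ℤ) * huv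
    · simp only [Matrix.of_apply, Matrix.cons_val]
      linear_combination -y * hx + x * hy

theorem exists_sl2_sending_to_normal_form (n : ℕ) (hn : 0 < n) (p q : ZMod n) :
    ∃ M : Matrix.SpecialLinearGroup (Fin 2) ℤ,
      sl2Smul n M (p, q) = ((gInv n (p, q) : ZMod n), 0) := by
  have : NeZero n := ⟨hn.ne'⟩
  obtain ⟨c, hgcd, hc⟩ :=
    Nat.exists_gcd_eq_natCast_eq p.val (m := q.val + n) (by lia) hn.ne'
  obtain ⟨M, h₁, h₂⟩ := exists_sl2_mul_add_eq_gcd c (q.val + n : ℕ)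
  rw [Int.gcd_natCast_natCast, hgcd, Nat.gcd_add_self_left] at h₁
  have hp := congrArg (Int.cast : ℤ → ZMod n) h₁
  have hq := congrArg (Int.cast : ℤ → ZMod n) h₂
  push_cast at hp hq
  simp only [hc, ZMod.natCast_zmod_val, ZMod.natCast_self, add_zero] at hp hq
  exact ⟨M, Prod.ext hp hq⟩
end

section
/- Let n be a positive integer. Two pairs (p,q) and (p',q') in (ℤ/nℤ)² lie in the same orbit of the SL₂(ℤ)-action on (ℤ/nℤ)² if and only if g(p,q) = g(p',q'), where g(p,q) = gcd(p̃, gcd(q̃, n)) and p̃, q̃ ∈ {0,…,n−1} are the canonical integer representatives. -/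
theorem sl2Smul_mul (n : ℕ) (M N : Matrix.SpecialLinearGroup (Fin 2) ℤ) (v : ZMod n × ZMod n) :
    sl2Smul n (M * N) v = sl2Smul n M (sl2Smul n N v) := by
  ext <;> simp [sl2Smul, Matrix.mul_apply, Fin.sum_univ_two] <;> ring

theorem sl2Smul_one (n : ℕ) (v : ZMod n × ZMod n) : sl2Smul n 1 v = v := by
  ext <;> simp [sl2Smul]

theorem sl2Smul_inv_smul (n : ℕ) (M : Matrix.SpecialLinearGroup (Fin 2) ℤ)
    (v : ZMod n × ZMod n) : sl2Smul n M⁻¹ (sl2Smul n M v) = v := by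
  rw [← sl2Smul_mul, inv_mul_cancel, sl2Smul_one]

theorem dvd_gInv_intCast_iff (n : ℕ) [NeZero n] (k : ℕ) (a b : ℤ) :
    k ∣ gInv n ((a : ZMod n), (b : ZMod n)) ↔ ((k : ℤ) ∣ a ∧ (k : ℤ) ∣ b) ∧ k ∣ n := by
  have key (c : ℤ) (hk : k ∣ n) : k ∣ (c : ZMod n).val ↔ (k : ℤ) ∣ c := by
    rw [← Int.natCast_dvd_natCast, ZMod.val_intCast,
      EuclideanDomain.dvd_mod_iff (Int.natCast_dvd_natCast.2 hk)]
  rw [gInv, Nat.dvd_gcd_iff, Nat.dvd_gcd_iff, ← and_assoc]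
  exact and_congr_left fun hk => and_congr (key a hk) (key b hk)

theorem gInv_intCast (n : ℕ) [NeZero n] (a b : ℤ) :
    gInv n ((a : ZMod n), (b : ZMod n)) = Nat.gcd (Int.gcd a b) n :=
  Nat.dvd_left_iff_eq.1 fun k => by
    rw [dvd_gInv_intCast_iff, Nat.dvd_gcd_iff, Int.dvd_gcd_iff]

theorem exists_intCast_eq (n : ℕ) (v : ZMod n × ZMod n) :
    ∃ a b : ℤ, v = ((a : ZMod n), (b : ZMod n)) := by
  obtain ⟨a, ha⟩ := ZMod.intCast_surjective v.1
  obtain ⟨b, hb⟩ := ZMod.intCast_surjective v.2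
  exact ⟨a, b, by rw [ha, hb]⟩

theorem gInv_dvd_gInv_sl2Smul (n : ℕ) [NeZero n] (M : Matrix.SpecialLinearGroup (Fin 2) ℤ)
    (v : ZMod n × ZMod n) : gInv n v ∣ gInv n (sl2Smul n M v) := by
  obtain ⟨a, b, rfl⟩ := exists_intCast_eq n v
  obtain ⟨⟨ha, hb⟩, hn⟩ := (dvd_gInv_intCast_iff n _ a b).1 dvd_rfl
  have h := (dvd_gInv_intCast_iff n _ (M.1 0 0 * a + M.1 0 1 * b) (M.1 1 0 * a + M.1 1 1 * b)).2
    ⟨⟨dvd_add (ha.mul_left _) (hb.mul_left _), dvd_add (ha.mul_left _) (hb.mul_left _)⟩, hn⟩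
  simpa only [sl2Smul, Int.cast_add, Int.cast_mul] using h

theorem gInv_sl2Smul (n : ℕ) [NeZero n] (M : Matrix.SpecialLinearGroup (Fin 2) ℤ)
    (v : ZMod n × ZMod n) : gInv n (sl2Smul n M v) = gInv n v := by
  refine Nat.dvd_antisymm ?_ (gInv_dvd_gInv_sl2Smul n M v)
  simpa only [sl2Smul_inv_smul] using gInv_dvd_gInv_sl2Smul n M⁻¹ (sl2Smul n M v)

/-- Bézout's identity: an integer vector can be moved to `(gcd a b, 0)` by `SL₂(ℤ)`. -/
theorem exists_sl2Smul_intCast_eq_gcd (n : ℕ) (a b : ℤ) :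
    ∃ M, sl2Smul n M ((a : ZMod n), (b : ZMod n)) = ((Int.gcd a b : ZMod n), 0) := by
  rcases eq_or_ne (Int.gcd a b) 0 with h | h
  · obtain ⟨rfl, rfl⟩ := Int.gcd_eq_zero_iff.1 h
    exact ⟨1, by simp [sl2Smul_one]⟩
  · obtain ⟨c, hc⟩ := Int.gcd_dvd_left a b
    obtain ⟨d, hd⟩ := Int.gcd_dvd_right a b
    have bezout := Int.gcd_eq_gcd_ab a b
    have h' : (Int.gcd a b : ℤ) ≠ 0 := Int.natCast_ne_zero.2 h
    generalize Int.gcdA a b = x at bezout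
    generalize Int.gcdB a b = y at bezout
    have hdet : (!![x, y; -d, c] : Matrix (Fin 2) (Fin 2) ℤ).det = 1 := by
      rw [Matrix.det_fin_two_of]
      apply mul_left_cancel₀ h'
      linear_combination -x * hc - y * hd - bezout
    have hzero : -d * a + c * b = 0 := by
      linear_combination -d * hc + c * hd
    refine ⟨⟨_, hdet⟩, Prod.ext ?_ ?_⟩
    · have := congrArg (Int.cast : ℤ → ZMod n) bezout
      push_cast at this
      simp only [sl2Smul, Matrix.of_apply, Matrix.cons_val_zero, Matrix.cons_val_one]
      rw [this]
      ring
    · have := congrArg (Int.cast : ℤ → ZMod n) hzero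
      push_cast at this
      simpa [sl2Smul] using this

theorem exists_sl2Smul_eq_gInv (n : ℕ) [NeZero n] (v : ZMod n × ZMod n) :
    ∃ M, sl2Smul n M v = ((gInv n v : ZMod n), 0) := by
  obtain ⟨a, b, rfl⟩ := exists_intCast_eq n v
  obtain ⟨M, hM⟩ := exists_sl2Smul_intCast_eq_gcd n a b
  obtain ⟨N, hN⟩ := exists_sl2Smul_intCast_eq_gcd n (Int.gcd a b) n
  refine ⟨N * M, ?_⟩
  rw [sl2Smul_mul, hM, gInv_intCast]
  simpa using hN

theorem sl2_same_orbit_iff_gInv_eq (n : ℕ) (hn : 0 < n) (v w : ZMod n × ZMod n) :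
    (∃ M : Matrix.SpecialLinearGroup (Fin 2) ℤ, sl2Smul n M v = w) ↔
      gInv n v = gInv n w := by
  have : NeZero n := ⟨hn.ne'⟩
  constructor
  · rintro ⟨M, rfl⟩
    exact (gInv_sl2Smul n M v).symm
  · intro h
    obtain ⟨M, hM⟩ := exists_sl2Smul_eq_gInv n v
    obtain ⟨N, hN⟩ := exists_sl2Smul_eq_gInv n w
    exact ⟨N⁻¹ * M, by rw [sl2Smul_mul, hM, h, ← hN, sl2Smul_inv_smul]⟩
end

section
/- Let n be a positive integer and define the two maps φ₁, φ₂ : (ℤ/nℤ)² → (ℤ/nℤ)² by φ₁(p,q) = (p+q, q) and φ₂(p,q) = (p, q+p). Then for every (p,q) ∈ (ℤ/nℤ)² there exists a finite composition f of the maps φ₁ and φ₂ (an element of the monoid generated by φ₁ and φ₂ under composition) such that f(p,q) = (g(p,q) mod n, 0), where g(p,q) = gcd(p̃, gcd(q̃, n)) and p̃, q̃ ∈ {0,…,n−1} are the canonical integer representatives. -/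
/-- The monodromy map `φ₁ : (p,q) ↦ (p+q, q)` on `(ℤ/nℤ)²`, as an element of the
monoid of self-maps under composition. -/
def phi1 (n : ℕ) : Function.End (ZMod n × ZMod n) := fun v => (v.1 + v.2, v.2)

/-- The monodromy map `φ₂ : (p,q) ↦ (p, q+p)` on `(ℤ/nℤ)²`, as an element of the
monoid of self-maps under composition. -/
def phi2 (n : ℕ) : Function.End (ZMod n × ZMod n) := fun v => (v.1, v.2 + v.1)

/-- `MonodromyReach n v w` says that some composition of `φ₁` and `φ₂` sends `v` to `w`. -/
def MonodromyReach (n : ℕ) (v w : ZMod n × ZMod n) : Prop :=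
  ∃ f ∈ Submonoid.closure ({phi1 n, phi2 n} : Set (Function.End (ZMod n × ZMod n))), f v = w

namespace MonodromyReach

variable {n : ℕ}

theorem trans {u v w : ZMod n × ZMod n} (h₁ : MonodromyReach n u v)
    (h₂ : MonodromyReach n v w) : MonodromyReach n u w := by
  obtain ⟨f, hf, rfl⟩ := h₁
  obtain ⟨g, hg, rfl⟩ := h₂
  exact ⟨g * f, mul_mem hg hf, rfl⟩

theorem shear_fst_nat (m : ℕ) (a b : ZMod n) : MonodromyReach n (a, b) (a + m * b, b) := by
  induction m with
  | zero => exact ⟨1, one_mem _, by simp [Function.End.one_def]⟩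
  | succ m ih =>
    refine ih.trans ⟨phi1 n, Submonoid.subset_closure (by simp), ?_⟩
    simp only [phi1, Nat.cast_succ]
    exact Prod.ext (by ring) rfl

theorem shear_snd_nat (m : ℕ) (a b : ZMod n) : MonodromyReach n (a, b) (a, b + m * a) := by
  induction m with
  | zero => exact ⟨1, one_mem _, by simp [Function.End.one_def]⟩
  | succ m ih =>
    refine ih.trans ⟨phi2 n, Submonoid.subset_closure (by simp), ?_⟩
    simp only [phi2, Nat.cast_succ]
    exact Prod.ext rfl (by ring)

variable [NeZero n]

theorem shear_fst (k a b : ZMod n) : MonodromyReach n (a, b) (a + k * b, b) := by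
  simpa using shear_fst_nat k.val a b

theorem shear_snd (k a b : ZMod n) : MonodromyReach n (a, b) (a, b + k * a) := by
  simpa using shear_snd_nat k.val a b

theorem zero_left (b : ZMod n) : MonodromyReach n (0, b) (b, 0) := by
  have h₁ := shear_fst 1 0 b
  have h₂ := shear_snd (-1) b b
  simp only [one_mul, zero_add, neg_mul, add_neg_cancel] at h₁ h₂
  exact h₁.trans h₂

theorem euclid (a b : ℕ) :
    MonodromyReach n (a, b) ((a.gcd b : ℕ), 0) ∧ MonodromyReach n (b, a) ((a.gcd b : ℕ), 0) := by
  induction a, b using Nat.gcd.induction with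
  | H0 b =>
    simp only [Nat.gcd_zero_left, Nat.cast_zero]
    exact ⟨zero_left _, by simpa using shear_snd 0 (b : ZMod n) 0⟩
  | H1 a b _ ih =>
    have hmod : (b : ZMod n) + -((b / a : ℕ) : ZMod n) * a = ((b % a : ℕ) : ZMod n) := by
      have h : (b : ZMod n) = (b % a : ℕ) + a * (b / a : ℕ) := by
        exact_mod_cast congrArg (Nat.cast : ℕ → ZMod n) (Nat.mod_add_div b a).symm
      linear_combination h
    have h₁ := shear_snd (-((b / a : ℕ) : ZMod n)) (a : ZMod n) b
    have h₂ := shear_fst (-((b / a : ℕ) : ZMod n)) (b : ZMod n) a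
    rw [hmod] at h₁ h₂
    rw [Nat.gcd_rec a b]
    exact ⟨h₁.trans ih.2, h₂.trans ih.1⟩

theorem reduce_gcd (d : ℕ) : MonodromyReach n (d, 0) ((d.gcd n : ℕ), 0) := by
  obtain ⟨c, hc⟩ := Nat.gcd_dvd_left d n
  have hbez : ((d.gcd n : ℕ) : ZMod n) = d * (d.gcdA n : ZMod n) := by
    have h := congrArg (Int.cast : ℤ → ZMod n) (Nat.gcd_eq_gcd_ab d n)
    simpa using h
  have hd : (d : ZMod n) = (d.gcd n : ℕ) * c := by
    exact_mod_cast congrArg (Nat.cast : ℕ → ZMod n) hc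
  have h₁ := shear_snd (d.gcdA n : ZMod n) (d : ZMod n) 0
  rw [zero_add, mul_comm, ← hbez] at h₁
  have h₂ := shear_fst (-(c : ZMod n)) (d : ZMod n) (d.gcd n : ℕ)
  rw [show (d : ZMod n) + -(c : ZMod n) * (d.gcd n : ℕ) = 0 by linear_combination hd] at h₂
  exact (h₁.trans h₂).trans (zero_left _)

end MonodromyReach

theorem monodromy_monoid_normal_form (n : ℕ) (hn : 0 < n) (p q : ZMod n) :
    ∃ f ∈ Submonoid.closure ({phi1 n, phi2 n} : Set (Function.End (ZMod n × ZMod n))),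
      f (p, q) = ((gInv n (p, q) : ZMod n), 0) := by
  have : NeZero n := ⟨hn.ne'⟩
  have h := ((MonodromyReach.euclid p.val q.val).1).trans
    (MonodromyReach.reduce_gcd (n := n) (p.val.gcd q.val))
  rw [Nat.gcd_assoc, ZMod.natCast_zmod_val, ZMod.natCast_zmod_val] at h
  exact h
end
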